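/- (Existence of a unique profile for (M1), Case A2, Theorem 2.6.) Assume κ⁻ > κ⁺ > 0 and let ρ⁻, ρ⁺ ∈ (0,1) satisfy ρ⁻ < ρ⁺ ≤ ρ̂ and f̄ := κ⁻ρ⁻v(ρ⁻) = κ⁺ρ⁺v(ρ⁺) > 0. Then there exists exactly one function Q : ℝ → [0,1] such that: Q(x) = ρ⁺ for all x > 0; Q is continuous and monotone nondecreasing on (−∞,0); κ⁻·Q(x)·v(A(Q;x)) = f̄ for all x < 0; the left limit at 0 satisfies κ⁻·Q(0−) = κ⁺·ρ⁺; and lim_{x→−∞} Q(x) = ρ⁻. -/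

import Mathlib

open Set Filter Topology MeasureTheory

/-- The nonlocal average `A(Q;x) = ∫₀ʰ Q(x+s) w(s) ds`. -/
noncomputable def avg (h : ℝ) (w Q : ℝ → ℝ) (x : ℝ) : ℝ := ∫ s in (0:ℝ)..h, Q (x + s) * w s

/-- The profile of Case A2: `Q ≡ ρ⁺` on `(0,∞)`, continuous and monotone nondecreasing on
`(−∞,0)`, satisfying `κ⁻·Q(x)·v(A(Q;x)) = f̄` on `(−∞,0)`, the connecting condition
`κ⁻·Q(0−) = κ⁺·ρ⁺`, and `Q → ρ⁻` as `x → −∞`. -/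
def IsProfileA2 (h : ℝ) (w v : ℝ → ℝ) (km kp fbar rhom rhop : ℝ) (Q : ℝ → ℝ) : Prop :=
  (∀ x, Q x ∈ Set.Icc (0:ℝ) 1) ∧
  (∀ x > (0:ℝ), Q x = rhop) ∧
  ContinuousOn Q (Set.Iio 0) ∧ MonotoneOn Q (Set.Iio 0) ∧
  (∀ x < (0:ℝ), km * Q x * v (avg h w Q x) = fbar) ∧
  (∃ qm : ℝ, Filter.Tendsto Q (nhdsWithin 0 (Set.Iio 0)) (nhds qm) ∧ km * qm = kp * rhop) ∧
  Filter.Tendsto Q Filter.atBot (nhds rhom)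

/-- A self-map of the monotone `[a, b]`-valued functions that preserves the pointwise order has a
fixed point. -/
theorem exists_monotone_fixedPoint {a b : ℝ} (hab : a ≤ b) (T : (ℝ → ℝ) → ℝ → ℝ)
    (hT : ∀ P, Monotone P → (∀ x, P x ∈ Icc a b) → Monotone (T P) ∧ ∀ x, T P x ∈ Icc a b)
    (hT' : ∀ P R, Monotone P → (∀ x, P x ∈ Icc a b) → Monotone R → (∀ x, R x ∈ Icc a b) →
      (∀ x, P x ≤ R x) → ∀ x, T P x ≤ T R x) :
    ∃ P, Monotone P ∧ (∀ x, P x ∈ Icc a b) ∧ T P = P := by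
  have : Fact (a ≤ b) := ⟨hab⟩
  have hm (P : ℝ →o Icc a b) : Monotone (fun x => (P x : ℝ)) := fun x y hxy => P.monotone hxy
  let F : (ℝ →o Icc a b) →o (ℝ →o Icc a b) :=
    { toFun := fun P =>
        { toFun := fun x => ⟨T (fun x => P x) x, (hT _ (hm P) fun x => (P x).2).2 x⟩
          monotone' := fun x y hxy => (hT _ (hm P) fun x => (P x).2).1 hxy }
      monotone' := fun P R hPR x =>
        hT' _ _ (hm P) (fun x => (P x).2) (hm R) (fun x => (R x).2) (fun x => hPR x) x }
  obtain ⟨P, hP⟩ : ∃ P, F P = P :=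
    ⟨OrderHom.lfp (α := ℝ →o Icc a b) F, OrderHom.map_lfp (α := ℝ →o Icc a b) F⟩
  exact ⟨fun x => P x, hm P, fun x => (P x).2,
    funext fun x => congrArg (fun P : ℝ →o Icc a b => (P x : ℝ)) hP⟩

section Average

variable {h : ℝ} {w : ℝ → ℝ} {P R : ℝ → ℝ} {a b : ℝ}

theorem intervalIntegrable_shift_mul (hw : IntervalIntegrable w volume 0 h)
    (hP : Monotone P) (hPab : ∀ x, P x ∈ Icc a b) (x : ℝ) :
    IntervalIntegrable (fun s => P (x + s) * w s) volume 0 h := by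
  have hm : Measurable fun s => P (x + s) := hP.measurable.comp (measurable_const_add x)
  have hb : ∀ s, ‖P (x + s)‖ ≤ max |a| |b| := fun s => abs_le_max_abs_abs (hPab _).1 (hPab _).2
  rw [intervalIntegrable_iff] at hw ⊢
  exact hw.bdd_mul hm.aestronglyMeasurable (Eventually.of_forall hb)

theorem avg_le_avg (hh : 0 < h) (hw : IntervalIntegrable w volume 0 h) (hw0 : ∀ s, 0 ≤ w s)
    (hP : Monotone P) (hPab : ∀ x, P x ∈ Icc a b) (hR : Monotone R)
    (hRab : ∀ x, R x ∈ Icc a b) {x y : ℝ} (hle : ∀ s ∈ Icc 0 h, P (x + s) ≤ R (y + s)) :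
    avg h w P x ≤ avg h w R y :=
  intervalIntegral.integral_mono_on hh.le (intervalIntegrable_shift_mul hw hP hPab x)
    (intervalIntegrable_shift_mul hw hR hRab y)
    fun s hs => mul_le_mul_of_nonneg_right (hle s hs) (hw0 s)

theorem avg_eq_of_forall (hh : 0 < h) (hw1 : (∫ s in (0:ℝ)..h, w s) = 1) {c x : ℝ}
    (hc : ∀ s ∈ Icc 0 h, P (x + s) = c) : avg h w P x = c := by
  have : avg h w P x = ∫ s in (0:ℝ)..h, c * w s :=
    intervalIntegral.integral_congr fun s hs => by
      rw [uIcc_of_le hh.le] at hs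
      simp only [hc s hs]
  rw [this, intervalIntegral.integral_const_mul, hw1, mul_one]

theorem le_avg (hh : 0 < h) (hw : IntervalIntegrable w volume 0 h) (hw0 : ∀ s, 0 ≤ w s)
    (hw1 : (∫ s in (0:ℝ)..h, w s) = 1) (hP : Monotone P) (hPab : ∀ x, P x ∈ Icc a b) (x : ℝ) :
    P x ≤ avg h w P x := by
  rw [← avg_eq_of_forall (P := fun _ => P x) (x := x) hh hw1 fun _ _ => rfl]
  exact avg_le_avg hh hw hw0 monotone_const (fun _ => hPab x) hP hPab
    fun s hs => hP (by linarith [hs.1])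

theorem avg_le (hh : 0 < h) (hw : IntervalIntegrable w volume 0 h) (hw0 : ∀ s, 0 ≤ w s)
    (hw1 : (∫ s in (0:ℝ)..h, w s) = 1) (hP : Monotone P) (hPab : ∀ x, P x ∈ Icc a b) (x : ℝ) :
    avg h w P x ≤ P (x + h) := by
  rw [← avg_eq_of_forall (P := fun _ => P (x + h)) (x := x) hh hw1 fun _ _ => rfl]
  exact avg_le_avg hh hw hw0 hP hPab monotone_const (fun _ => hPab (x + h))
    fun s hs => hP (by linarith [hs.2])

theorem avg_mem_Icc (hh : 0 < h) (hw : IntervalIntegrable w volume 0 h) (hw0 : ∀ s, 0 ≤ w s)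
    (hw1 : (∫ s in (0:ℝ)..h, w s) = 1) (hP : Monotone P) (hPab : ∀ x, P x ∈ Icc a b) (x : ℝ) :
    avg h w P x ∈ Icc a b :=
  ⟨(hPab x).1.trans (le_avg hh hw hw0 hw1 hP hPab x),
    (avg_le hh hw hw0 hw1 hP hPab x).trans (hPab _).2⟩

theorem tendsto_avg_atBot (hh : 0 < h) (hw : IntervalIntegrable w volume 0 h)
    (hw0 : ∀ s, 0 ≤ w s) (hw1 : (∫ s in (0:ℝ)..h, w s) = 1) (hP : Monotone P)
    (hPab : ∀ x, P x ∈ Icc a b) {l : ℝ} (hl : Tendsto P atBot (𝓝 l)) :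
    Tendsto (avg h w P) atBot (𝓝 l) :=
  tendsto_of_tendsto_of_tendsto_of_le_of_le hl
    (hl.comp (tendsto_atBot_add_const_right _ h tendsto_id))
    (le_avg hh hw hw0 hw1 hP hPab) (avg_le hh hw hw0 hw1 hP hPab)

theorem continuous_avg (hw : IntervalIntegrable w volume 0 h)
    (hP : Monotone P) (hPab : ∀ x, P x ∈ Icc a b) : Continuous (avg h w P) := by
  refine continuous_iff_continuousAt.2 fun x => ?_
  refine intervalIntegral.continuousAt_of_dominated_interval
    (bound := fun s => max |a| |b| * ‖w s‖) ?_ ?_ (hw.norm.const_mul _) ?_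
  · exact Eventually.of_forall fun y =>
      (intervalIntegrable_iff.1 (intervalIntegrable_shift_mul hw hP hPab y)).aestronglyMeasurable
  · refine Eventually.of_forall fun y => Eventually.of_forall fun s _ => ?_
    rw [norm_mul]
    exact mul_le_mul_of_nonneg_right (abs_le_max_abs_abs (hPab _).1 (hPab _).2) (norm_nonneg _)
  · have hc : {s | ¬ ContinuousAt P (x + s)}.Countable :=
      hP.countable_not_continuousAt.preimage (add_right_injective x)
    filter_upwards [compl_mem_ae_iff.2 (hc.measure_zero volume)] with s hs _
    have hs' : ContinuousAt P (x + s) := not_not.1 hs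
    exact (ContinuousAt.comp (f := fun y => y + s) hs' (by fun_prop)).mul continuousAt_const

/-- Values at a single point do not influence the nonlocal average. -/
theorem avg_congr_of_ne {z : ℝ} (hPR : ∀ y ≠ z, P y = R y) (x : ℝ) :
    avg h w P x = avg h w R x := by
  refine intervalIntegral.integral_congr_ae ?_
  filter_upwards [compl_mem_ae_iff.2 (measure_singleton (μ := volume) (z - x))] with s hs _
  rw [hPR _ fun hz => hs (by rw [mem_singleton_iff]; linarith)]

/-- Gronwall-type uniqueness: two functions agreeing on `[0, ∞)` whose difference is controlled by
the difference of their averages on `(-∞, 0)` coincide. -/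
theorem eq_of_abs_sub_le_avg (hh : 0 < h) (hw : IntervalIntegrable w volume 0 h)
    (hw0 : ∀ s, 0 ≤ w s) {M : ℝ} (hM : ∀ s, w s ≤ M)
    (hP : Monotone P) (hPab : ∀ x, P x ∈ Icc a b) (hR : Monotone R) (hRab : ∀ x, R x ∈ Icc a b)
    (heq : ∀ x, 0 ≤ x → P x = R x) {L : ℝ} (hL : 0 ≤ L)
    (hlip : ∀ x < 0, |P x - R x| ≤ L * |avg h w P x - avg h w R x|) : P = R := by
  have hM0 : 0 ≤ M := (hw0 0).trans (hM 0)
  have hab : 0 ≤ b - a := by linarith [(hPab 0).1, (hPab 0).2]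
  obtain ⟨k, hk0, hk⟩ : ∃ k : ℝ, 0 < k ∧ 2 * (L * M) ≤ k :=
    ⟨2 * (L * M) + 1, by positivity, by linarith⟩
  have step : ∀ c : ℝ, 0 ≤ c → (∀ x, |P x - R x| ≤ c * Real.exp (-k * x)) →
      ∀ x, |P x - R x| ≤ c / 2 * Real.exp (-k * x) := by
    intro c hc H x
    rcases le_or_gt 0 x with hx | hx
    · rw [heq x hx, sub_self, abs_zero]
      positivity
    have hsub : avg h w P x - avg h w R x
        = ∫ s in (0:ℝ)..h, (P (x + s) * w s - R (x + s) * w s) :=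
      (intervalIntegral.integral_sub (intervalIntegrable_shift_mul hw hP hPab x)
        (intervalIntegrable_shift_mul hw hR hRab x)).symm
    have hcont : Continuous fun s : ℝ => c * Real.exp (-k * (x + s)) * M := by fun_prop
    have hbound : |avg h w P x - avg h w R x|
        ≤ ∫ s in (0:ℝ)..h, c * Real.exp (-k * (x + s)) * M := by
      rw [hsub, ← Real.norm_eq_abs]
      refine intervalIntegral.norm_integral_le_of_norm_le hh.le
        (Eventually.of_forall fun s _ => ?_) (hcont.intervalIntegrable _ _)
      rw [← sub_mul, Real.norm_eq_abs, abs_mul, abs_of_nonneg (hw0 s)]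
      exact mul_le_mul (H _) (hM s) (hw0 s) (by positivity)
    have hint : (∫ s in (0:ℝ)..h, c * Real.exp (-k * (x + s)) * M)
        = -(c * M / k) * Real.exp (-k * (x + h)) - -(c * M / k) * Real.exp (-k * (x + 0)) := by
      refine intervalIntegral.integral_eq_sub_of_hasDerivAt
        (f := fun s => -(c * M / k) * Real.exp (-k * (x + s))) (fun s _ => ?_)
        (hcont.intervalIntegrable _ _)
      have h1 : HasDerivAt (fun s : ℝ => -k * (x + s)) (-k * 1) s :=
        ((hasDerivAt_id s).const_add x).const_mul (-k)
      refine (h1.exp.const_mul (-(c * M / k))).congr_deriv ?_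
      field_simp
    have hle : |avg h w P x - avg h w R x| ≤ c * M / k * Real.exp (-k * x) := by
      refine hbound.trans ?_
      rw [hint, add_zero]
      have : 0 ≤ c * M / k * Real.exp (-k * (x + h)) := by positivity
      linarith
    calc |P x - R x| ≤ L * (c * M / k * Real.exp (-k * x)) :=
          (hlip x hx).trans (mul_le_mul_of_nonneg_left hle hL)
      _ = c * (L * M / k) * Real.exp (-k * x) := by ring
      _ ≤ c * (1 / 2) * Real.exp (-k * x) := by
          have : L * M / k ≤ 1 / 2 := by
            rw [div_le_iff₀ hk0]
            linarith
          gcongr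
      _ = c / 2 * Real.exp (-k * x) := by ring
  have all : ∀ n : ℕ, ∀ x, |P x - R x| ≤ (b - a) * (1 / 2) ^ n * Real.exp (-k * x) := by
    intro n
    induction n with
    | zero =>
      intro x
      rw [pow_zero, mul_one]
      rcases le_or_gt 0 x with hx | hx
      · rw [heq x hx, sub_self, abs_zero]
        positivity
      · have h1 : |P x - R x| ≤ b - a :=
          abs_le.2 ⟨by linarith [(hPab x).1, (hRab x).2], by linarith [(hPab x).2, (hRab x).1]⟩
        exact h1.trans (le_mul_of_one_le_right hab (Real.one_le_exp (by nlinarith)))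
    | succ n ih =>
      intro x
      convert step _ (by positivity) ih x using 2
      ring
  funext x
  have hlim : Tendsto (fun n : ℕ => (b - a) * (1 / 2 : ℝ) ^ n * Real.exp (-k * x)) atTop
      (𝓝 ((b - a) * 0 * Real.exp (-k * x))) :=
    ((tendsto_pow_atTop_nhds_zero_of_lt_one (by norm_num) (by norm_num)).const_mul _).mul_const _
  have h0 := ge_of_tendsto' hlim fun n => all n x
  rw [mul_zero, zero_mul] at h0
  exact sub_eq_zero.1 (abs_nonpos_iff.1 h0)

end Average

/-- Replacing the value at `0` by `c` turns a profile into a globally monotone function. -/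
theorem IsProfileA2.monotone_ite {h km kp fbar a c : ℝ} {w v Q : ℝ → ℝ}
    (hQ : IsProfileA2 h w v km kp fbar a c Q) (hkm : 0 < km) (hc : kp * c ≤ km * c) :
    Monotone (fun x => if x < 0 then Q x else c) ∧
      ∀ x < 0, Q x ∈ Icc a c := by
  obtain ⟨-, -, -, hmono, -, ⟨q, hq, hqc⟩, hbot⟩ := hQ
  have hqle : q ≤ c := le_of_mul_le_mul_left (hqc.trans_le hc) hkm
  have hle : ∀ x < 0, Q x ≤ c := fun x hx => by
    refine (ge_of_tendsto hq ?_).trans hqle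
    filter_upwards [Ioo_mem_nhdsLT hx] with y hy
    exact hmono hx hy.2 hy.1.le
  refine ⟨fun x y hxy => ?_, fun x hx => ⟨le_of_tendsto hbot ?_, hle x hx⟩⟩
  · dsimp only
    split_ifs with hx hy hy
    · exact hmono hx hy hxy
    · exact hle x hx
    · linarith
    · exact le_rfl
  · filter_upwards [eventually_le_atBot x] with y hy
    exact hmono (hy.trans_lt hx) hx hy

/-- **Theorem 2.6, Case A2.** For `κ⁻ > κ⁺ > 0` and `ρ⁻ < ρ⁺ ≤ ρ̂` with
`f̄ = κ⁻ρ⁻v(ρ⁻) = κ⁺ρ⁺v(ρ⁺) > 0`, there is exactly one stationary profile: it equals `ρ⁺`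
on `(0,∞)`, is continuous and monotone nondecreasing on `(−∞,0)`, satisfies the flux
equation on `(−∞,0)`, the connecting condition at `0`, and tends to `ρ⁻` at `−∞`.
(Uniqueness holds away from the single point `x = 0`.) -/
theorem stmt_10 (h : ℝ) (hh : 0 < h) (w : ℝ → ℝ)
    (hw_supp : ∀ x, x ∉ Ioo 0 h → w x = 0)
    (hw_cont : ContinuousOn w (Ioo 0 h))
    (hw_bdd : ∃ Mw, ∀ x, w x ≤ Mw)
    (hw_pos : ∀ x ∈ Ioo 0 h, 0 < w x)
    (hw_anti : StrictAntiOn w (Ioo 0 h))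
    (hw_int1 : (∫ s in (0:ℝ)..h, w s) = 1)
    (v : ℝ → ℝ) (hv : ContDiffOn ℝ 2 v (Icc 0 1))
    (hv0 : v 0 = 1) (hv1 : v 1 = 0)
    (hv'neg : ∀ ρ ∈ Icc (0:ℝ) 1, deriv v ρ < 0)
    (hv''np : ∀ ρ ∈ Icc (0:ℝ) 1, deriv (deriv v) ρ ≤ 0)
    (rhohat : ℝ) (hrhohat_mem : rhohat ∈ Ioo (0:ℝ) 1)
    (hrhohat_crit : deriv (fun ρ => ρ * v ρ) rhohat = 0)
    (hrhohat_uniq : ∀ ρ ∈ Ioo (0:ℝ) 1, deriv (fun ρ => ρ * v ρ) ρ = 0 → ρ = rhohat)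
    (km kp : ℝ) (hk : 0 < kp ∧ kp < km)
    (rhom rhop fbar : ℝ)
    (hrhom : rhom ∈ Ioo (0:ℝ) 1) (hrhop : rhop ∈ Ioo (0:ℝ) 1)
    (hord : rhom < rhop ∧ rhop ≤ rhohat)
    (hfm : fbar = km * (rhom * v rhom)) (hfp : fbar = kp * (rhop * v rhop))
    (hfpos : 0 < fbar) :
    ∃ Q : ℝ → ℝ, IsProfileA2 h w v km kp fbar rhom rhop Q ∧
      ∀ Q' : ℝ → ℝ, IsProfileA2 h w v km kp fbar rhom rhop Q' →
        ∀ x ≠ (0:ℝ), Q' x = Q x := by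
  have hw0 : ∀ s, 0 ≤ w s := fun s => by
    by_cases hs : s ∈ Ioo 0 h
    · exact (hw_pos s hs).le
    · exact (hw_supp s hs).ge
  have hwi : IntervalIntegrable w volume 0 h := by
    by_contra hn
    rw [intervalIntegral.integral_undef hn] at hw_int1
    exact zero_ne_one hw_int1
  obtain ⟨M, hM⟩ := hw_bdd
  obtain ⟨hkp, hkpm⟩ := hk
  have hkm : 0 < km := hkp.trans hkpm
  have hvd : ∀ ρ ∈ Icc (0:ℝ) 1, DifferentiableAt ℝ v ρ := fun ρ hρ =>
    differentiableAt_of_deriv_ne_zero (hv'neg ρ hρ).ne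
  have hanti : StrictAntiOn v (Icc 0 1) :=
    strictAntiOn_of_deriv_neg (convex_Icc 0 1) hv.continuousOn
      fun ρ hρ => hv'neg ρ (interior_subset hρ)
  have hsub : Icc rhom rhop ⊆ Icc (0:ℝ) 1 := Icc_subset_Icc hrhom.1.le hrhop.2.le
  have hm01 : rhom ∈ Icc (0:ℝ) 1 := Ioo_subset_Icc_self hrhom
  have hp01 : rhop ∈ Icc (0:ℝ) 1 := Ioo_subset_Icc_self hrhop
  have hvp : 0 < v rhop := hv1 ▸ hanti hp01 (right_mem_Icc.2 zero_le_one) hrhop.2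
  have hvge : ∀ ρ ∈ Icc rhom rhop, v rhop ≤ v ρ := fun ρ hρ =>
    hanti.antitoneOn (hsub hρ) hp01 hρ.2
  have hvle : ∀ ρ ∈ Icc rhom rhop, v ρ ≤ v rhom := fun ρ hρ =>
    hanti.antitoneOn hm01 (hsub hρ) hρ.1
  have hvpos : ∀ ρ ∈ Icc rhom rhop, 0 < v ρ := fun ρ hρ => hvp.trans_le (hvge ρ hρ)
  have hcle : kp * rhop ≤ km * rhop := mul_le_mul_of_nonneg_right hkpm.le hrhop.1.le
  -- the flux equation solved for the density upstream of the nonlocal average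
  have hg_anti : ∀ ρ ∈ Icc rhom rhop, ∀ σ ∈ Icc rhom rhop, ρ ≤ σ →
      fbar / (km * v ρ) ≤ fbar / (km * v σ) := fun ρ hρ σ hσ hle =>
    div_le_div_of_nonneg_left hfpos.le (mul_pos hkm (hvpos σ hσ))
      (mul_le_mul_of_nonneg_left (hanti.antitoneOn (hsub hρ) (hsub hσ) hle) hkm.le)
  have hgm : fbar / (km * v rhom) = rhom := by
    have := hvpos rhom (left_mem_Icc.2 hord.1.le)
    rw [hfm]; field_simp
  have hgp : fbar / (km * v rhop) = kp * rhop / km := by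
    rw [hfp]; field_simp
  have hgp' : fbar / (km * v rhop) ≤ rhop := by
    rw [hgp, div_le_iff₀ hkm]; linarith
  have hg_mem : ∀ ρ ∈ Icc rhom rhop, fbar / (km * v ρ) ∈ Icc rhom rhop := fun ρ hρ =>
    ⟨hgm.symm.le.trans (hg_anti _ (left_mem_Icc.2 hord.1.le) _ hρ hρ.1),
      (hg_anti _ hρ _ (right_mem_Icc.2 hord.1.le) hρ.2).trans hgp'⟩
  have hg_cont : ∀ ρ ∈ Icc rhom rhop, ContinuousAt (fun σ => fbar / (km * v σ)) ρ := fun ρ hρ =>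
    continuousAt_const.div (continuousAt_const.mul (hvd ρ (hsub hρ)).continuousAt)
      (mul_pos hkm (hvpos ρ hρ)).ne'
  obtain ⟨Q, hQm, hQab, hQT⟩ := exists_monotone_fixedPoint hord.1.le
    (fun P x => if x < 0 then fbar / (km * v (avg h w P x)) else rhop)
    (fun P hP hPab => by
      have hA := avg_mem_Icc hh hwi hw0 hw_int1 hP hPab
      refine ⟨fun x y hxy => ?_, fun x => ?_⟩
      · dsimp only
        split_ifs with hx hy hy
        · exact hg_anti _ (hA x) _ (hA y)
            (avg_le_avg hh hwi hw0 hP hPab hP hPab fun s _ => hP (by linarith))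
        · exact (hg_mem _ (hA x)).2
        · linarith
        · exact le_rfl
      · split_ifs with hx
        · exact hg_mem _ (hA x)
        · exact right_mem_Icc.2 hord.1.le)
    (fun P R hP hPab hR hRab hPR x => by
      split_ifs with hx
      · exact hg_anti _ (avg_mem_Icc hh hwi hw0 hw_int1 hP hPab x) _
          (avg_mem_Icc hh hwi hw0 hw_int1 hR hRab x)
          (avg_le_avg hh hwi hw0 hP hPab hR hRab fun s _ => hPR _)
      · exact le_rfl)
  have hA := avg_mem_Icc hh hwi hw0 hw_int1 hQm hQab
  have hQneg : ∀ x < 0, Q x = fbar / (km * v (avg h w Q x)) := fun x hx => by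
    conv_lhs => rw [← hQT]
    exact if_pos hx
  have hQpos : ∀ x, 0 ≤ x → Q x = rhop := fun x hx => by
    rw [← hQT]
    exact if_neg hx.not_gt
  have hQflux : ∀ x < (0:ℝ), km * Q x * v (avg h w Q x) = fbar := fun x hx => by
    have := hvpos _ (hA x)
    rw [hQneg x hx]; field_simp
  have hGc : Continuous fun x => fbar / (km * v (avg h w Q x)) :=
    continuous_iff_continuousAt.2 fun x =>
      ContinuousAt.comp (g := fun σ => fbar / (km * v σ)) (hg_cont _ (hA x))
        (continuous_avg hwi hQm hQab).continuousAt
  refine ⟨Q, ⟨fun x => hsub (hQab x), fun x hx => hQpos x hx.le, ?_, hQm.monotoneOn _, hQflux,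
    ⟨kp * rhop / km, ?_, by field_simp⟩, ?_⟩, ?_⟩
  · exact hGc.continuousOn.congr hQneg
  · have h0 : avg h w Q 0 = rhop :=
      avg_eq_of_forall hh hw_int1 fun s hs => hQpos _ (by linarith [hs.1])
    have ht : Tendsto (fun x => fbar / (km * v (avg h w Q x))) (𝓝[<] 0) (𝓝 (kp * rhop / km)) := by
      rw [← hgp, ← h0]
      exact hGc.continuousAt.continuousWithinAt
    exact ht.congr' (eventually_nhdsWithin_of_forall fun x hx => (hQneg x hx).symm)
  · obtain ⟨l, hl⟩ : ∃ l, Tendsto Q atBot (𝓝 l) :=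
      ⟨_, tendsto_atBot_ciInf hQm ⟨rhom, forall_mem_range.2 fun x => (hQab x).1⟩⟩
    have hlm : l ∈ Icc rhom rhop := isClosed_Icc.mem_of_tendsto hl (Eventually.of_forall hQab)
    have hAl := tendsto_avg_atBot hh hwi hw0 hw_int1 hQm hQab hl
    have hfl : km * l * v l = fbar := by
      refine tendsto_nhds_unique (((hl.const_mul km).mul
        ((hvd l (hsub hlm)).continuousAt.tendsto.comp hAl)).congr' ?_) tendsto_const_nhds
      filter_upwards [eventually_lt_atBot (0:ℝ)] with x hx
      exact hQflux x hx
    rcases hlm.1.eq_or_lt with he | hlt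
    · rwa [he]
    · have heq : rhom * v rhom = l * v l :=
        mul_left_cancel₀ hkm.ne' (by rw [← hfm, ← hfl]; ring)
      obtain ⟨c, hc, hc0⟩ := exists_deriv_eq_zero (f := fun ρ => ρ * v ρ) hlt
        (continuousOn_id.mul (hv.continuousOn.mono (Icc_subset_Icc hm01.1 (hsub hlm).2))) heq
      have hch := hrhohat_uniq c ⟨hrhom.1.trans hc.1, hc.2.trans_le (hsub hlm).2⟩ hc0
      linarith [hc.2, hlm.2, hord.2]
  · intro Q' hQ' x hx
    obtain ⟨hRm, hRab'⟩ := hQ'.monotone_ite hkm hcle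
    obtain ⟨-, hQ'pos, -, -, hQ'flux, -, -⟩ := hQ'
    set R : ℝ → ℝ := fun x => if x < 0 then Q' x else rhop with hR
    have hRneg : ∀ y < 0, R y = Q' y := fun y hy => if_pos hy
    have hRpos : ∀ y, 0 ≤ y → R y = rhop := fun y hy => if_neg hy.not_gt
    have hRab : ∀ y, R y ∈ Icc rhom rhop := fun y => by
      rcases lt_or_ge y 0 with hy | hy
      · exact hRneg y hy ▸ hRab' y hy
      · rw [hRpos y hy]
        exact right_mem_Icc.2 hord.1.le
    have hQR : ∀ y ≠ 0, Q' y = R y := fun y hy => by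
      rcases hy.lt_or_gt with hy | hy
      · exact (hRneg y hy).symm
      · rw [hQ'pos y hy, hRpos y hy.le]
    have hRflux : ∀ y < 0, km * R y * v (avg h w R y) = fbar := fun y hy => by
      rw [← avg_congr_of_ne hQR, hRneg y hy, hQ'flux y hy]
    have hB := avg_mem_Icc hh hwi hw0 hw_int1 hRm hRab
    obtain ⟨K, hK⟩ := (hv.of_le one_le_two).exists_lipschitzOnWith one_ne_zero
      (convex_Icc 0 1) isCompact_Icc
    have hQRe : R = Q := by
      refine eq_of_abs_sub_le_avg hh hwi hw0 hM hRm hRab hQm hQab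
        (fun y hy => (hRpos y hy).trans (hQpos y hy).symm)
        (L := K / v rhop) (div_nonneg K.2 hvp.le) fun y hy => ?_
      have hvB := hvge _ (hB y)
      have hprod : (R y - Q y) * v (avg h w R y)
          = Q y * (v (avg h w Q y) - v (avg h w R y)) := by
        refine mul_left_cancel₀ hkm.ne' ?_
        linear_combination hRflux y hy - hQflux y hy
      have hd := hK.dist_le_mul _ (hsub (hB y)) _ (hsub (hA y))
      rw [Real.dist_eq, Real.dist_eq] at hd
      have habs := congrArg abs hprod
      rw [abs_mul, abs_mul, abs_of_pos (hvpos _ (hB y)), abs_sub_comm (v (avg h w Q y)),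
        abs_of_nonneg (hsub (hQab y)).1] at habs
      rw [div_mul_eq_mul_div, le_div_iff₀ hvp]
      calc |R y - Q y| * v rhop ≤ |R y - Q y| * v (avg h w R y) := by gcongr
        _ = Q y * |v (avg h w R y) - v (avg h w Q y)| := habs
        _ ≤ 1 * |v (avg h w R y) - v (avg h w Q y)| := by
          gcongr
          exact (hsub (hQab y)).2
        _ ≤ K * |avg h w R y - avg h w Q y| := by rwa [one_mul]
    rw [hQR x hx, hQRe]
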